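/- arXiv:1307.0278 — 2 statements merged into one kernel-verified Lean document; each statement's English description precedes it below -/
import Mathlib

section
/- Let G be a connected graph with no induced K_{1,3} and no induced P_5. If G contains an induced cycle C of length at least 4, then there exists a set V of at most 5 vertices of G (namely V(C)) such that G minus V contains no independent set of size 3. -/
open SimpleGraph

namespace SimpleGraph

variable {V : Type*} {G : SimpleGraph V}

/-- The centre of a claw and its three pairwise nonadjacent leaves cannot occur together. -/
theorem false_of_claw (hclaw : ¬ Nonempty (completeBipartiteGraph (Fin 1) (Fin 3) ↪g G))
    {x a b c : V} (ha : G.Adj x a) (hb : G.Adj x b) (hc : G.Adj x c)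
    (nab : a ≠ b) (nac : a ≠ c) (nbc : b ≠ c)
    (hab : ¬ G.Adj a b) (hac : ¬ G.Adj a c) (hbc : ¬ G.Adj b c) : False := by
  have key : ∀ i j, G.Adj (Sum.elim (fun _ : Fin 1 => x) ![a, b, c] i)
      (Sum.elim (fun _ : Fin 1 => x) ![a, b, c] j) ↔
      (completeBipartiteGraph (Fin 1) (Fin 3)).Adj i j := by
    rintro (i | i) (j | j) <;> fin_cases i <;> fin_cases j <;>
      simp [ha, hb, hc, ha.symm, hb.symm, hc.symm, hab, hac, hbc,
        G.adj_comm b a, G.adj_comm c a, G.adj_comm c b]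
  refine hclaw ⟨⟨⟨Sum.elim (fun _ => x) ![a, b, c], ?_⟩, key _ _⟩⟩
  rintro (i | i) (j | j) h <;> fin_cases i <;> fin_cases j <;>
    simp_all [ha.ne, hb.ne, hc.ne, ha.ne', hb.ne', hc.ne', nab.symm, nac.symm, nbc.symm]

/-- Five vertices inducing exactly the edges of a path cannot occur in a `P_5`-free graph. -/
theorem false_of_path (hP5 : ¬ Nonempty (pathGraph 5 ↪g G)) {a b c d e : V}
    (hab : G.Adj a b) (hbc : G.Adj b c) (hcd : G.Adj c d) (hde : G.Adj d e)
    (hac : ¬ G.Adj a c) (had : ¬ G.Adj a d) (hae : ¬ G.Adj a e)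
    (hbd : ¬ G.Adj b d) (hbe : ¬ G.Adj b e) (hce : ¬ G.Adj c e) : False := by
  have key : ∀ i j : Fin 5, G.Adj (![a, b, c, d, e] i) (![a, b, c, d, e] j) ↔
      (pathGraph 5).Adj i j := by
    intro i j
    fin_cases i <;> fin_cases j <;>
      simp [pathGraph_adj, hab, hbc, hcd, hde, hab.symm, hbc.symm, hcd.symm, hde.symm,
        hac, had, hae, hbd, hbe, hce, G.adj_comm c a, G.adj_comm d a, G.adj_comm e a,
        G.adj_comm d b, G.adj_comm e b, G.adj_comm e c]
  refine hP5 ⟨⟨⟨![a, b, c, d, e], fun i j h => ?_⟩, key _ _⟩⟩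
  have hrow : ∀ i j : Fin 5, (∀ k, (pathGraph 5).Adj i k ↔ (pathGraph 5).Adj j k) → i = j := by
    simp only [pathGraph_adj]
    decide
  exact hrow i j fun k => by rw [← key, ← key, h]

/-- An induced cycle in a `P_5`-free graph has length at most five. -/
theorem cycleGraph_le_five (hP5 : ¬ Nonempty (pathGraph 5 ↪g G)) {n : ℕ}
    (f : cycleGraph n ↪g G) : n ≤ 5 := by
  by_contra! hn
  obtain ⟨m, rfl⟩ : ∃ m, n = m + 6 := ⟨n - 6, by omega⟩
  have hadj : ∀ i j : ℕ, (hi : i < 5) → (hj : j < 5) →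
      (G.Adj (f ⟨i, by omega⟩) (f ⟨j, by omega⟩) ↔ j = i + 1 ∨ i = j + 1) := by
    intro i j hi hj
    rw [f.map_adj_iff, cycleGraph_adj']
    simp only [Fin.sub_def]
    have mod : ∀ k l : ℕ, k < 5 → l < 5 →
        ((m + 6 - l + k) % (m + 6) = 1 ↔ k = l + 1) := by
      intro k l hk hl
      rcases lt_or_ge k l with h | h
      · rw [Nat.mod_eq_of_lt (by omega)]
        omega
      · rw [show m + 6 - l + k = k - l + (m + 6) by omega, Nat.add_mod_right,
          Nat.mod_eq_of_lt (by omega)]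
        omega
    rw [mod i j hi hj, mod j i hj hi, or_comm]
  apply false_of_path hP5 (a := f ⟨0, by omega⟩) (b := f ⟨1, by omega⟩) (c := f ⟨2, by omega⟩)
    (d := f ⟨3, by omega⟩) (e := f ⟨4, by omega⟩) <;> rw [hadj] <;> omega

/-- If some vertex set is nonempty and closed under adjacency, it is everything in a connected
graph. -/
theorem Connected.mem_of_adj_closed (hconn : G.Connected) {s : Set V} {u : V} (hu : u ∈ s)
    (hs : ∀ v w, v ∈ s → G.Adj v w → w ∈ s) (v : V) : v ∈ s := by
  obtain ⟨p⟩ := hconn.preconnected u v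
  induction p with
  | nil => exact hu
  | cons h _ ih => exact ih (hs _ _ hu h)

section Embedding

variable {ι : Type*} {H : SimpleGraph ι} (f : H ↪g G)

/-- Two nonadjacent neighbours of a vertex of an induced subgraph: a vertex outside that sees the
centre sees one of them. -/
theorem adj_or_adj_of_claw_free
    (hclaw : ¬ Nonempty (completeBipartiteGraph (Fin 1) (Fin 3) ↪g G)) {v : V}
    (hv : v ∉ Set.range f) {i j k : ι} (hij : H.Adj i j) (hik : H.Adj i k) (njk : j ≠ k)
    (hjk : ¬ H.Adj j k) (h : G.Adj v (f i)) : G.Adj v (f j) ∨ G.Adj v (f k) := by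
  by_contra! hn
  exact false_of_claw hclaw h.symm (f.map_adj_iff.2 hij) (f.map_adj_iff.2 hik)
    (fun e => hv ⟨_, e.symm⟩) (fun e => hv ⟨_, e.symm⟩) (f.injective.ne njk) hn.1 hn.2
    (mt f.map_adj_iff.1 hjk)

/-- If two nonadjacent outside vertices see the same vertex of an induced subgraph, then one of
them sees any given neighbour of it. -/
theorem adj_or_adj_of_claw_free_of_not_adj
    (hclaw : ¬ Nonempty (completeBipartiteGraph (Fin 1) (Fin 3) ↪g G)) {v w : V}
    (hv : v ∉ Set.range f) (hw : w ∉ Set.range f) (nvw : v ≠ w) (hvw : ¬ G.Adj v w) {i j : ι}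
    (hij : H.Adj i j) (hvi : G.Adj v (f i)) (hwi : G.Adj w (f i)) :
    G.Adj v (f j) ∨ G.Adj w (f j) := by
  by_contra! hn
  exact false_of_claw hclaw hvi.symm hwi.symm (f.map_adj_iff.2 hij) nvw
    (fun e => hv ⟨_, e.symm⟩) (fun e => hw ⟨_, e.symm⟩) hvw hn.1 hn.2

/-- Two nonadjacent vertices attached to the two ends of an induced path on three vertices have
a further neighbour on the path. -/
theorem adj_of_path_three (hP5 : ¬ Nonempty (pathGraph 5 ↪g G)) {v w : V} (hvw : ¬ G.Adj v w)
    {i j k : ι} (hij : H.Adj i j) (hjk : H.Adj j k) (hik : ¬ H.Adj i k)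
    (hvi : G.Adj v (f i)) (hwk : G.Adj w (f k)) :
    G.Adj v (f j) ∨ G.Adj v (f k) ∨ G.Adj w (f i) ∨ G.Adj w (f j) := by
  by_contra! hn
  exact false_of_path hP5 hvi (f.map_adj_iff.2 hij) (f.map_adj_iff.2 hjk) hwk.symm hn.1 hn.2.1
    hvw (mt f.map_adj_iff.1 hik) (fun h => hn.2.2.1 h.symm) (fun h => hn.2.2.2 h.symm)

/-- A vertex attached to the end of an induced path on four vertices has a further neighbour on
the path. -/
theorem adj_of_path_four (hP5 : ¬ Nonempty (pathGraph 5 ↪g G)) {v : V} {i j k l : ι}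
    (hij : H.Adj i j) (hjk : H.Adj j k) (hkl : H.Adj k l) (hik : ¬ H.Adj i k)
    (hil : ¬ H.Adj i l) (hjl : ¬ H.Adj j l) (hvi : G.Adj v (f i)) :
    G.Adj v (f j) ∨ G.Adj v (f k) ∨ G.Adj v (f l) := by
  by_contra! hn
  exact false_of_path hP5 hvi (f.map_adj_iff.2 hij) (f.map_adj_iff.2 hjk) (f.map_adj_iff.2 hkl)
    hn.1 hn.2.1 hn.2.2 (mt f.map_adj_iff.1 hik) (mt f.map_adj_iff.1 hil)
    (mt f.map_adj_iff.1 hjl)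

/-- Three pairwise nonadjacent vertices, consecutive ones joined through nonadjacent vertices
`f i` and `f j`: one of the end vertices sees both `f i` and `f j`. -/
theorem adj_of_alternating_path (hP5 : ¬ Nonempty (pathGraph 5 ↪g G)) {u v w : V}
    (huv : ¬ G.Adj u v) (huw : ¬ G.Adj u w) (hvw : ¬ G.Adj v w) {i j : ι} (hij : ¬ H.Adj i j)
    (hui : G.Adj u (f i)) (hvi : G.Adj v (f i)) (hvj : G.Adj v (f j)) (hwj : G.Adj w (f j)) :
    G.Adj u (f j) ∨ G.Adj w (f i) := by
  by_contra! hn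
  exact false_of_path hP5 hui hvi.symm hvj hwj.symm huv hn.1 huw (mt f.map_adj_iff.1 hij)
    (fun h => hn.2 h.symm) hvw

/-- In a connected `{K_{1,3}, P_5}`-free graph, an induced subgraph dominates as soon as each of
its vertices is the start of two induced paths on three vertices whose second vertices are distinct
and nonadjacent. -/
theorem Connected.exists_adj_of_not_mem_range [Nonempty ι] (hconn : G.Connected)
    (hclaw : ¬ Nonempty (completeBipartiteGraph (Fin 1) (Fin 3) ↪g G))
    (hP5 : ¬ Nonempty (pathGraph 5 ↪g G))
    (hH : ∀ i, ∃ j k, j ≠ k ∧ ¬ H.Adj j k ∧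
      (H.Adj i j ∧ ∃ l, H.Adj j l ∧ l ≠ i ∧ ¬ H.Adj i l) ∧
      (H.Adj i k ∧ ∃ l, H.Adj k l ∧ l ≠ i ∧ ¬ H.Adj i l))
    {v : V} (hv : v ∉ Set.range f) : ∃ i, G.Adj v (f i) := by
  have := hconn.mem_of_adj_closed (s := {v | v ∈ Set.range f ∨ ∃ i, G.Adj v (f i)})
    (u := f (Classical.arbitrary ι)) (Or.inl ⟨_, rfl⟩) (by
      rintro v w hv hvw
      by_cases hw : w ∈ Set.range f
      · exact Or.inl hw
      refine Or.inr ?_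
      rcases hv with ⟨i, rfl⟩ | ⟨i, hi⟩
      · exact ⟨i, hvw.symm⟩
      by_contra! hn
      have clique : ∀ {a b}, a ≠ b → ¬ H.Adj a b → G.Adj v (f a) → ¬ G.Adj v (f b) :=
        fun nab hab h₁ h₂ => false_of_claw hclaw hvw h₁ h₂ (fun e => hw ⟨_, e.symm⟩)
          (fun e => hw ⟨_, e.symm⟩) (f.injective.ne nab) (hn _) (hn _)
          (mt f.map_adj_iff.1 hab)
      have step : ∀ {j}, H.Adj i j → (∃ l, H.Adj j l ∧ l ≠ i ∧ ¬ H.Adj i l) →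
          G.Adj v (f j) := by
        rintro j hij ⟨l, hjl, hli, hil⟩
        by_contra hj
        exact false_of_path hP5 hvw.symm hi (f.map_adj_iff.2 hij) (f.map_adj_iff.2 hjl) (hn _)
          (hn _) (hn _) hj (clique hli.symm hil hi) (mt f.map_adj_iff.1 hil)
      obtain ⟨j, k, njk, hjk, ⟨hij, hj⟩, hik, hk⟩ := hH i
      exact clique njk hjk (step hij hj) (step hik hk)) v
  exact this.resolve_left hv

end Embedding

/-- Three pairwise nonadjacent vertices cannot all lie outside an induced cycle of length four in a
connected `{K_{1,3}, P_5}`-free graph. -/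
theorem false_of_independent_triple_of_cycle_four (hconn : G.Connected)
    (hclaw : ¬ Nonempty (completeBipartiteGraph (Fin 1) (Fin 3) ↪g G))
    (hP5 : ¬ Nonempty (pathGraph 5 ↪g G)) (f : cycleGraph 4 ↪g G) {x y z : V}
    (hx : x ∉ Set.range f) (hy : y ∉ Set.range f) (hz : z ∉ Set.range f)
    (nxy : x ≠ y) (nxz : x ≠ z) (nyz : y ≠ z)
    (hxy : ¬ G.Adj x y) (hxz : ¬ G.Adj x z) (hyz : ¬ G.Adj y z) : False := by
  have dom : ∀ v ∉ Set.range f, ∃ i, G.Adj v (f i) := fun v hv =>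
    hconn.exists_adj_of_not_mem_range f hclaw hP5 (by decide) hv
  have pair : ∀ v ∉ Set.range f, ∀ i, G.Adj v (f i) →
      G.Adj v (f (i + 1)) ∨ G.Adj v (f (i + 3)) := fun v hv i =>
    adj_or_adj_of_claw_free f hclaw hv (by decide +revert) (by decide +revert)
      (by decide +revert) (by decide +revert)
  have triple : ∀ i, ¬ (G.Adj x (f i) ∧ G.Adj y (f i) ∧ G.Adj z (f i)) := fun i h =>
    false_of_claw hclaw h.1.symm h.2.1.symm h.2.2.symm nxy nxz nyz hxy hxz hyz
  have next : ∀ v ∉ Set.range f, ∀ w ∉ Set.range f, v ≠ w → ¬ G.Adj v w → ∀ i,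
      G.Adj v (f i) → G.Adj w (f i) →
      (G.Adj v (f (i + 1)) ∨ G.Adj w (f (i + 1))) ∧
      (G.Adj v (f (i + 3)) ∨ G.Adj w (f (i + 3))) := fun v hv w hw nvw hvw i h₁ h₂ =>
    by
      constructor <;>
        refine adj_or_adj_of_claw_free_of_not_adj f hclaw hv hw nvw hvw ?_ h₁ h₂ <;>
        clear h₁ h₂ <;> decide +revert
  have path : ∀ v w, ¬ G.Adj v w → ∀ i, G.Adj v (f i) → G.Adj w (f (i + 2)) →
      G.Adj v (f (i + 1)) ∨ G.Adj v (f (i + 2)) ∨ G.Adj w (f i) ∨ G.Adj w (f (i + 1)) :=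
    fun v w hvw i => adj_of_path_three f hP5 hvw (by decide +revert) (by decide +revert)
      (by decide +revert)
  have alt : ∀ u v w, ¬ G.Adj u v → ¬ G.Adj u w → ¬ G.Adj v w → ∀ i,
      G.Adj u (f i) → G.Adj v (f i) → G.Adj v (f (i + 2)) → G.Adj w (f (i + 2)) →
      G.Adj u (f (i + 2)) ∨ G.Adj w (f i) := fun u v w h₁ h₂ h₃ i =>
    adj_of_alternating_path f hP5 h₁ h₂ h₃ (by decide +revert)
  have hyx : ¬ G.Adj y x := fun h => hxy h.symm
  have hzx : ¬ G.Adj z x := fun h => hxz h.symm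
  have hzy : ¬ G.Adj z y := fun h => hyz h.symm
  have dx := dom x hx
  have dy := dom y hy
  have dz := dom z hz
  have px := pair x hx
  have py := pair y hy
  have pz := pair z hz
  have nxy' := next x hx y hy nxy hxy
  have nxz' := next x hx z hz nxz hxz
  have nyz' := next y hy z hz nyz hyz
  have qxy := path x y hxy
  have qxz := path x z hxz
  have qyx := path y x hyx
  have qyz := path y z hyz
  have qzx := path z x hzx
  have qzy := path z y hzy
  have ax := alt y x z hyx hyz hxz
  have ay := alt x y z hxy hxz hyz
  have az := alt x z y hxz hxy hzy
  clear dom pair next path alt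
  simp only [Fin.forall_fin_succ, Fin.exists_fin_succ, Fin.succ_zero_eq_one, Fin.succ_one_eq_two,
    IsEmpty.forall_iff, IsEmpty.exists_iff, Fin.reduceSucc, Fin.reduceAdd, zero_add, and_true,
    or_false] at *
  clear hconn hclaw hP5 hx hy hz
  grind (splits := 30)

/-- Three pairwise nonadjacent vertices cannot all lie outside an induced cycle of length five in a
connected `{K_{1,3}, P_5}`-free graph. -/
theorem false_of_independent_triple_of_cycle_five (hconn : G.Connected)
    (hclaw : ¬ Nonempty (completeBipartiteGraph (Fin 1) (Fin 3) ↪g G))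
    (hP5 : ¬ Nonempty (pathGraph 5 ↪g G)) (f : cycleGraph 5 ↪g G) {x y z : V}
    (hx : x ∉ Set.range f) (hy : y ∉ Set.range f) (hz : z ∉ Set.range f)
    (nxy : x ≠ y) (nxz : x ≠ z) (nyz : y ≠ z)
    (hxy : ¬ G.Adj x y) (hxz : ¬ G.Adj x z) (hyz : ¬ G.Adj y z) : False := by
  have dom : ∀ v ∉ Set.range f, ∃ i, G.Adj v (f i) := fun v hv =>
    hconn.exists_adj_of_not_mem_range f hclaw hP5 (by decide) hv
  have pair : ∀ v ∉ Set.range f, ∀ i, G.Adj v (f i) →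
      G.Adj v (f (i + 1)) ∨ G.Adj v (f (i + 4)) := fun v hv i =>
    adj_or_adj_of_claw_free f hclaw hv (by decide +revert) (by decide +revert)
      (by decide +revert) (by decide +revert)
  have path : ∀ v, ∀ i, G.Adj v (f i) →
      (G.Adj v (f (i + 1)) ∨ G.Adj v (f (i + 2)) ∨ G.Adj v (f (i + 3))) ∧
      (G.Adj v (f (i + 4)) ∨ G.Adj v (f (i + 3)) ∨ G.Adj v (f (i + 2))) := fun v i h => by
    constructor <;> refine adj_of_path_four f hP5 ?_ ?_ ?_ ?_ ?_ ?_ h <;> clear h <;>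
      decide +revert
  -- Outside vertices cannot miss two nonadjacent vertices of the cycle.
  have miss : ∀ v ∉ Set.range f, ∀ i, G.Adj v (f i) ∨ G.Adj v (f (i + 2)) := by
    intro v hv
    have d := dom v hv
    have p := pair v hv
    have q := path v
    clear dom pair path hconn hclaw hP5 hx hy hz hv
    simp only [Fin.forall_fin_succ, Fin.exists_fin_succ, Fin.succ_zero_eq_one, Fin.succ_one_eq_two,
      IsEmpty.forall_iff, IsEmpty.exists_iff, Fin.reduceSucc, Fin.reduceAdd, zero_add, and_true,
      or_false] at *
    grind (splits := 20)
  have triple : ∀ i, ¬ (G.Adj x (f i) ∧ G.Adj y (f i) ∧ G.Adj z (f i)) := fun i h =>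
    false_of_claw hclaw h.1.symm h.2.1.symm h.2.2.symm nxy nxz nyz hxy hxz hyz
  have alt : ∀ i, G.Adj y (f i) → G.Adj x (f i) →
      (G.Adj x (f (i + 2)) → G.Adj z (f (i + 2)) → G.Adj y (f (i + 2)) ∨ G.Adj z (f i)) ∧
      (G.Adj x (f (i + 3)) → G.Adj z (f (i + 3)) → G.Adj y (f (i + 3)) ∨ G.Adj z (f i)) :=
    fun i h₁ h₂ => by
      constructor <;>
        refine adj_of_alternating_path f hP5 (fun h => hxy h.symm) hyz hxz ?_ h₁ h₂ <;>
        clear h₁ h₂ <;> decide +revert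
  have mx := miss x hx
  have my := miss y hy
  have mz := miss z hz
  clear dom pair path miss hconn hclaw hP5 hx hy hz
  simp only [Fin.forall_fin_succ, Fin.succ_zero_eq_one, Fin.succ_one_eq_two, IsEmpty.forall_iff,
    Fin.reduceSucc, Fin.reduceAdd, zero_add, and_true] at *
  grind (splits := 20)

end SimpleGraph

/-- In a connected `{K_{1,3}, P_5}`-free graph containing an induced cycle of
length at least 4, there is a set of at most 5 vertices (namely the cycle's
vertex set) whose removal leaves no independent set of size 3. -/
theorem claw_P5_free_cycle_remove_five {V : Type*} (G : SimpleGraph V) (hconn : G.Connected)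
    (hclaw : ¬ Nonempty (completeBipartiteGraph (Fin 1) (Fin 3) ↪g G))
    (hP5 : ¬ Nonempty (pathGraph 5 ↪g G))
    (n : ℕ) (hn : 4 ≤ n) (f : cycleGraph n ↪g G) :
    ∃ S : Set V, S = Set.range f ∧ S.ncard ≤ 5 ∧
      ¬ ∃ a b c : V, a ∉ S ∧ b ∉ S ∧ c ∉ S ∧ a ≠ b ∧ a ≠ c ∧ b ≠ c ∧
        ¬ G.Adj a b ∧ ¬ G.Adj a c ∧ ¬ G.Adj b c := by
  obtain rfl | rfl : n = 4 ∨ n = 5 := by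
    have := cycleGraph_le_five hP5 f
    omega
  · refine ⟨_, rfl, ?_, ?_⟩
    · rw [← Set.image_univ, Set.ncard_image_of_injective _ f.injective]
      simp
    · rintro ⟨a, b, c, ha, hb, hc, hab, hac, hbc, nab, nac, nbc⟩
      exact false_of_independent_triple_of_cycle_four hconn hclaw hP5 f ha hb hc hab hac hbc
        nab nac nbc
  · refine ⟨_, rfl, ?_, ?_⟩
    · rw [← Set.image_univ, Set.ncard_image_of_injective _ f.injective]
      simp
    · rintro ⟨a, b, c, ha, hb, hc, hab, hac, hbc, nab, nac, nbc⟩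
      exact false_of_independent_triple_of_cycle_five hconn hclaw hP5 f ha hb hc hab hac hbc
        nab nac nbc
end

section
/- Let G be a connected graph with no induced K_{1,3} and no induced hammer. Then at least one of the following holds: (1) G is a simple cycle; (2) G contains an induced C_6; (3) G has a vertex of degree 1; (4) G contains no induced P_5; (5) there is a set of at most 5 vertices whose removal leaves a graph with no independent set of size 3. -/
open SimpleGraph

/-- The hammer: a triangle `0,1,2` with a pendant path `0 - 3 - 4`. -/
def hammer : SimpleGraph (Fin 5) :=
  SimpleGraph.fromEdgeSet {s(0, 1), s(0, 2), s(1, 2), s(0, 3), s(3, 4)}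

section

variable {V : Type*} {G : SimpleGraph V}

/-- Pointwise form of claw-freeness. -/
def ClawFree (G : SimpleGraph V) : Prop :=
  ∀ x a b c, G.Adj x a → G.Adj x b → G.Adj x c → a ≠ b → a ≠ c → b ≠ c →
    G.Adj a b ∨ G.Adj a c ∨ G.Adj b c

/-- Pointwise form of hammer-freeness: the triangle is `a, b, c` and the pendant path `a - d - e`. -/
def HammerFree (G : SimpleGraph V) : Prop :=
  ∀ a b c d e, G.Adj a b → G.Adj a c → G.Adj b c → G.Adj a d → G.Adj d e →
    G.Adj a e ∨ G.Adj b d ∨ G.Adj b e ∨ G.Adj c d ∨ G.Adj c e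

/-- Five vertices forming an induced path. -/
def IsP5 (G : SimpleGraph V) (a b c d e : V) : Prop :=
  (G.Adj a b ∧ G.Adj b c ∧ G.Adj c d ∧ G.Adj d e) ∧
  (¬ G.Adj a c ∧ ¬ G.Adj a d ∧ ¬ G.Adj a e ∧ ¬ G.Adj b d ∧ ¬ G.Adj b e ∧ ¬ G.Adj c e) ∧
  a ≠ c ∧ a ≠ d ∧ a ≠ e ∧ b ≠ d ∧ b ≠ e ∧ c ≠ e

/-- Five vertices forming an induced cycle. -/
def IsC5 (G : SimpleGraph V) (a b c d e : V) : Prop :=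
  (G.Adj a b ∧ G.Adj b c ∧ G.Adj c d ∧ G.Adj d e ∧ G.Adj e a) ∧
  (¬ G.Adj a c ∧ ¬ G.Adj a d ∧ ¬ G.Adj b d ∧ ¬ G.Adj b e ∧ ¬ G.Adj c e)

/-- Six vertices forming an induced cycle. -/
def IsC6 (G : SimpleGraph V) (a b c d e f : V) : Prop :=
  (G.Adj a b ∧ G.Adj b c ∧ G.Adj c d ∧ G.Adj d e ∧ G.Adj e f ∧ G.Adj f a) ∧
  (¬ G.Adj a c ∧ ¬ G.Adj a d ∧ ¬ G.Adj a e ∧ ¬ G.Adj b d ∧ ¬ G.Adj b e ∧ ¬ G.Adj b f ∧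
    ¬ G.Adj c e ∧ ¬ G.Adj c f ∧ ¬ G.Adj d f)

/-- The possible neighbourhoods, on an induced path `a b c d e`, of a vertex `v` that does not
prolong it. -/
def MeetsP5 (G : SimpleGraph V) (v a b c d e : V) : Prop :=
  (G.Adj v b ∧ G.Adj v d ∧ (G.Adj v c ∨ G.Adj v a ∧ G.Adj v e)) ∨
  (G.Adj v a ∧ ¬ G.Adj v b ∧ G.Adj v c ∧ G.Adj v d ∧ ¬ G.Adj v e) ∨
  (¬ G.Adj v a ∧ G.Adj v b ∧ G.Adj v c ∧ ¬ G.Adj v d ∧ G.Adj v e)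

/-- `v` is adjacent to at least four of `a, b, c, d, e`. -/
def MeetsC5 (G : SimpleGraph V) (v a b c d e : V) : Prop :=
  (G.Adj v a ∧ G.Adj v b ∧ G.Adj v c ∧ G.Adj v d) ∨
  (G.Adj v b ∧ G.Adj v c ∧ G.Adj v d ∧ G.Adj v e) ∨
  (G.Adj v c ∧ G.Adj v d ∧ G.Adj v e ∧ G.Adj v a) ∨
  (G.Adj v d ∧ G.Adj v e ∧ G.Adj v a ∧ G.Adj v b) ∨
  (G.Adj v e ∧ G.Adj v a ∧ G.Adj v b ∧ G.Adj v c)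

/-- The first `k` values of `p` form an induced path. -/
def IsIndPath (G : SimpleGraph V) (k : ℕ) (p : ℕ → V) : Prop :=
  ∀ i < k, ∀ j < k, (p i = p j → i = j) ∧ (G.Adj (p i) (p j) ↔ i + 1 = j ∨ j + 1 = i)

theorem clawFree_of_not_nonempty_embedding
    (h : ¬ Nonempty (completeBipartiteGraph (Fin 1) (Fin 3) ↪g G)) : ClawFree G := by
  intro x a b c xa xb xc ab ac bc
  by_contra! hn
  obtain ⟨h1, h2, h3⟩ := hn
  refine h ⟨⟨⟨Sum.elim (fun _ => x) ![a, b, c], ?_⟩, ?_⟩⟩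
  · have := xa.ne; have := xb.ne; have := xc.ne
    rintro (i | i) (j | j) hij <;> fin_cases i <;> fin_cases j <;> simp_all
  · have := xa.symm; have := xb.symm; have := xc.symm
    have := mt G.adj_symm h1; have := mt G.adj_symm h2; have := mt G.adj_symm h3
    intro i j
    change G.Adj (Sum.elim (fun _ => x) ![a, b, c] i) (Sum.elim (fun _ => x) ![a, b, c] j) ↔ _
    rcases i with i | i <;> rcases j with j | j <;> fin_cases i <;> fin_cases j <;> simp_all

theorem hammerFree_of_not_nonempty_embedding (h : ¬ Nonempty (hammer ↪g G)) : HammerFree G := by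
  intro a b c d e ab ac bc ad de
  by_contra! hn
  obtain ⟨ae, bd, be, cd, ce⟩ := hn
  refine h ⟨⟨⟨![a, b, c, d, e], ?_⟩, ?_⟩⟩
  · intro i j hij
    fin_cases i <;> fin_cases j <;> simp_all [G.adj_comm]
  · intro i j
    have := ab.ne; have := ac.ne; have := bc.ne; have := ad.ne; have := de.ne
    change G.Adj (![a, b, c, d, e] i) (![a, b, c, d, e] j) ↔ _
    fin_cases i <;> fin_cases j <;> simp_all [hammer, G.adj_comm]

theorem IsC6.nonempty_embedding {a b c d e f : V} (h : IsC6 G a b c d e f) :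
    Nonempty (cycleGraph 6 ↪g G) := by
  obtain ⟨⟨ab, bc, cd, de, ef, fa⟩, ac, ad, ae, bd, be, bf, ce, cf, df⟩ := h
  refine ⟨⟨⟨![a, b, c, d, e, f], ?_⟩, ?_⟩⟩
  · intro i j hij
    fin_cases i <;> fin_cases j <;> simp_all [G.adj_comm]
  · intro i j
    change G.Adj (![a, b, c, d, e, f] i) (![a, b, c, d, e, f] j) ↔ _
    fin_cases i <;> fin_cases j <;> simp_all [cycleGraph_adj, G.adj_comm] <;> decide

theorem IsP5.neighbour_pattern (hC : ClawFree G) (hH : HammerFree G)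
    (h5 : ∀ a b c d e, ¬ IsC5 G a b c d e) (h6 : ∀ a b c d e f, ¬ IsC6 G a b c d e f)
    {a b c d e v : V} (hP : IsP5 G a b c d e)
    (va : v ≠ a) (vb : v ≠ b) (vc : v ≠ c) (vd : v ≠ d) (ve : v ≠ e)
    (hL : G.Adj v a → G.Adj v b ∨ G.Adj v c ∨ G.Adj v d ∨ G.Adj v e)
    (hR : G.Adj v e → G.Adj v a ∨ G.Adj v b ∨ G.Adj v c ∨ G.Adj v d)
    (hN : G.Adj v a ∨ G.Adj v b ∨ G.Adj v c ∨ G.Adj v d ∨ G.Adj v e) :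
    MeetsP5 G v a b c d e := by
  obtain ⟨⟨ab, bc, cd, de⟩, ⟨ac, ad, ae, bd, be, ce⟩, ac', ad', ae', bd', be', ce'⟩ := hP
  unfold MeetsP5
  have c1 := hC b a c v
  have c2 := hC c b d v
  have c3 := hC d c e v
  have c4 := hC v a c e
  have m1 := hH b a v c d
  have m2 := hH c b v d e
  have m3 := hH c d v b a
  have m4 := hH d e v c b
  have m5 := hH v d e a b
  have m6 := hH v a b e d
  have f1 := h5 v a b c d
  have f2 := h5 v b c d e
  have f3 := h6 v a b c d e
  unfold IsC5 at f1 f2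
  unfold IsC6 at f3
  simp only [G.adj_comm _ v] at *
  grind [G.adj_comm]

theorem IsC5.neighbour_pattern (hC : ClawFree G) (hH : HammerFree G)
    {a b c d e v : V} (hP : IsC5 G a b c d e)
    (va : v ≠ a) (vb : v ≠ b) (vc : v ≠ c) (vd : v ≠ d) (ve : v ≠ e)
    (hN : G.Adj v a ∨ G.Adj v b ∨ G.Adj v c ∨ G.Adj v d ∨ G.Adj v e) :
    MeetsC5 G v a b c d e := by
  obtain ⟨⟨ab, bc, cd, de, ea⟩, ac, ad, bd, be, ce⟩ := hP
  unfold MeetsC5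
  have c1 := hC b a c v
  have c2 := hC c b d v
  have c3 := hC d c e v
  have c4 := hC e d a v
  have c5 := hC a e b v
  have m1 := hH b a v c d
  have m2 := hH c b v d e
  have m3 := hH d c v e a
  have m4 := hH e d v a b
  have m5 := hH a e v b c
  have n1 := hH a b v e d
  have n2 := hH b c v a e
  have n3 := hH c d v b a
  have n4 := hH d e v c b
  have n5 := hH e a v d c
  have := ab.ne; have := bc.ne; have := cd.ne; have := de.ne; have := ea.ne
  grind [G.adj_comm]

theorem ClawFree.not_adj_two_apart_of_isIndPath_six (hC : ClawFree G) (hH : HammerFree G)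
    {a b c d e f w : V} (h1 : IsP5 G a b c d e) (h2 : IsP5 G b c d e f)
    (af : ¬ G.Adj a f) (af' : a ≠ f) (wb : w ≠ b) (wc : w ≠ c) (wd : w ≠ d) (we : w ≠ e)
    (wa : G.Adj w a) : ¬ G.Adj w b ∧ ¬ G.Adj w c := by
  obtain ⟨⟨ab, bc, cd, de⟩, ⟨ac, ad, ae, bd, be, ce⟩, ac', ad', ae', bd', be', ce'⟩ := h1
  obtain ⟨⟨-, -, -, ef⟩, ⟨-, -, bf, -, cf, df⟩, -, -, bf', -, cf', df'⟩ := h2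
  have c1 := hC c b d w
  have c2 := hC w a c e
  have c3 := hC w a c f
  have c4 := hC w a d f
  have c5 := hC d c e w
  have m1 := hH d c w e f
  have m2 := hH c b w d e
  have m3 := hH b a w c d
  have m4 := hH w a b e f
  simp only [G.adj_comm _ w] at *
  grind [G.adj_comm]

theorem adj_succ_of_adj_of_isP5 (hC : ClawFree G) (hH : HammerFree G)
    {x a b c d e f v : V} (h0 : IsP5 G x a b c d) (h1 : IsP5 G a b c d e) (h2 : IsP5 G b c d e f)
    (af : ¬ G.Adj a f) (af' : a ≠ f) (vx : v ≠ x) (vb : v ≠ b) (vd : v ≠ d)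
    (va : G.Adj v a) : G.Adj v b := by
  obtain ⟨⟨xa, -, -, -⟩, ⟨xb, xc, -, -, -, -⟩, xb', -⟩ := h0
  obtain ⟨⟨ab, bc, cd, de⟩, ⟨ac, ad, ae, bd, be, ce⟩, ac', ad', ae', bd', be', ce'⟩ := h1
  obtain ⟨⟨-, -, -, ef⟩, ⟨-, -, bf, -, cf, df⟩, -, -, bf', -, cf', df'⟩ := h2
  have c1 := hC a x b v
  have c2 := hC c b d v
  have c3 := hC v a c e
  have c4 := hC v a c f
  have m1 := hH a x v b c
  have m2 := hH d c v e f
  grind [G.adj_comm]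

theorem IsC5.not_three_independent (hC : ClawFree G)
    {a b c d e : V} {T : Set V}
    (hT : ∀ v ∉ T, MeetsC5 G v a b c d e) :
    ¬ ∃ x y z : V, x ∉ T ∧ y ∉ T ∧ z ∉ T ∧ x ≠ y ∧ x ≠ z ∧ y ≠ z ∧
      ¬ G.Adj x y ∧ ¬ G.Adj x z ∧ ¬ G.Adj y z := by
  rintro ⟨x, y, z, hx, hy, hz, xy, xz, yz, nxy, nxz, nyz⟩
  have hx := hT x hx
  have hy := hT y hy
  have hz := hT z hz
  have key : ∀ u, ¬ (G.Adj x u ∧ G.Adj y u ∧ G.Adj z u) := fun u ⟨h1, h2, h3⟩ => by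
    have := hC u x y z h1.symm h2.symm h3.symm xy xz yz
    tauto
  have h1 := key a
  have h2 := key b
  have h3 := key c
  have h4 := key d
  have h5 := key e
  clear key hT
  unfold MeetsC5 at hx hy hz
  rcases hx with hx | hx | hx | hx | hx <;> rcases hy with hy | hy | hy | hy | hy <;> simp_all

theorem IsP5.not_three_independent (hC : ClawFree G) (h6 : ∀ a b c d e f, ¬ IsC6 G a b c d e f)
    {a b c d e : V} (hP : IsP5 G a b c d e) {T : Set V}
    (hT : ∀ v ∉ T, MeetsP5 G v a b c d e) :
    ¬ ∃ x y z : V, x ∉ T ∧ y ∉ T ∧ z ∉ T ∧ x ≠ y ∧ x ≠ z ∧ y ≠ z ∧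
      ¬ G.Adj x y ∧ ¬ G.Adj x z ∧ ¬ G.Adj y z := by
  rintro ⟨x, y, z, hx, hy, hz, xy, xz, yz, nxy, nxz, nyz⟩
  have hx := hT x hx
  have hy := hT y hy
  have hz := hT z hz
  have key : ∀ u, ¬ (G.Adj x u ∧ G.Adj y u ∧ G.Adj z u) := fun u ⟨h1, h2, h3⟩ => by
    have := hC u x y z h1.symm h2.symm h3.symm xy xz yz
    tauto
  have hex : ∀ p q r, G.Adj p a → G.Adj p e → G.Adj q a → G.Adj q c → G.Adj r c → G.Adj r e →
      ¬ G.Adj p q → ¬ G.Adj p r → ¬ G.Adj q r → ¬ G.Adj p c → ¬ G.Adj q e → ¬ G.Adj r a →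
      False := by
    intro p q r pa pe qa qc rc re pq pr qr pc qe ra
    exact h6 p a q c r e ⟨⟨pa, qa.symm, qc, rc.symm, re, pe.symm⟩, pq, pc, pr, hP.2.1.1,
      mt G.adj_symm ra, hP.2.1.2.2.1, qr, qe, hP.2.1.2.2.2.2.2⟩
  unfold MeetsP5 at hx hy hz
  have h1 := key b
  have h2 := key c
  have h3 := key d
  have e1 := hex x y z
  have e2 := hex x z y
  have e3 := hex y x z
  have e4 := hex y z x
  have e5 := hex z x y
  have e6 := hex z y x
  grind [G.adj_comm]

/-- A nonempty vertex set closed under adjacency in a connected graph is everything. -/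
theorem SimpleGraph.Connected.mem_of_adj_closed_s7 (hG : G.Connected) {U : Set V} {u : V}
    (hu : u ∈ U) (hU : ∀ x ∈ U, ∀ y, G.Adj x y → y ∈ U) (v : V) : v ∈ U := by
  obtain ⟨w⟩ := hG.preconnected u v
  induction w with
  | nil => exact hu
  | cons h _ ih => exact ih (hU _ hu _ h)

theorem ClawFree.exists_adj_of_not_mem (hC : ClawFree G) (hG : G.Connected) {T : Set V} {t : V}
    (ht : t ∈ T) (hT : ∀ v ∉ T, (∃ u ∈ T, G.Adj v u) →
      ∃ x ∈ T, ∃ y ∈ T, x ≠ y ∧ ¬ G.Adj x y ∧ G.Adj v x ∧ G.Adj v y)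
    {v : V} (hv : v ∉ T) : ∃ u ∈ T, G.Adj v u := by
  have := hG.mem_of_adj_closed_s7 (U := {v | v ∉ T → ∃ u ∈ T, G.Adj v u}) (u := t)
    (fun h => absurd ht h) (fun x hx y hxy hy => ?_) v
  · exact this hv
  by_cases hxT : x ∈ T
  · exact ⟨x, hxT, hxy.symm⟩
  obtain ⟨a, ha, b, hb, hab, nab, xa, xb⟩ := hT x hxT (hx hxT)
  have hya : y ≠ a := fun h => hy (h ▸ ha)
  have hyb : y ≠ b := fun h => hy (h ▸ hb)
  rcases hC x y a b hxy xa xb hya hyb hab with h | h | h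
  · exact ⟨a, ha, h⟩
  · exact ⟨b, hb, h⟩
  · exact absurd h nab

theorem Set.ncard_insert_five_le (a b c d e : V) : ({a, b, c, d, e} : Set V).ncard ≤ 5 := by
  classical
  have : ({a, b, c, d, e} : Set V) = (({a, b, c, d, e} : Finset V) : Set V) := by simp
  rw [this, Set.ncard_coe_finset]
  exact Finset.card_le_five

theorem cycleGraph_adj_iff_val {n : ℕ} (hn : 2 ≤ n) {u v : Fin n} :
    (cycleGraph n).Adj u v ↔ u.val + 1 = v.val ∨ v.val + 1 = u.val ∨
      (u.val = 0 ∧ v.val + 1 = n) ∨ (v.val = 0 ∧ u.val + 1 = n) := by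
  rw [cycleGraph_adj']
  rcases lt_trichotomy u v with h | rfl | h
  · rw [Fin.coe_sub_iff_lt.2 h, Fin.coe_sub_iff_le.2 h.le]
    have := Fin.lt_def.1 h
    omega
  · have : NeZero n := ⟨by omega⟩
    have h0 : (u - u).val = 0 := by simp
    rw [h0]
    omega
  · rw [Fin.coe_sub_iff_lt.2 h, Fin.coe_sub_iff_le.2 h.le]
    have := Fin.lt_def.1 h
    omega

theorem isIndPath_of_pathGraph_embedding {n : ℕ} (f : pathGraph (n + 1) ↪g G) :
    IsIndPath G (n + 1) fun i => f (Fin.ofNat (n + 1) i) := by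
  intro i hi j hj
  refine ⟨fun h => ?_, ?_⟩
  · simpa [Fin.ext_iff, Nat.mod_eq_of_lt, hi, hj] using f.injective h
  · simp [f.map_adj_iff, pathGraph_adj, Nat.mod_eq_of_lt, hi, hj]

theorem isIndPath_of_cycleGraph_embedding {m : ℕ} (f : cycleGraph (m + 7) ↪g G)
    (i : Fin (m + 7)) : IsIndPath G 6 fun k => f (i + Fin.ofNat (m + 7) k) := by
  intro k hk l hl
  have hk' : k < m + 7 := by omega
  have hl' : l < m + 7 := by omega
  refine ⟨fun h => ?_, ?_⟩
  · simpa [Fin.ext_iff, Nat.mod_eq_of_lt, hk', hl'] using f.injective h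
  · rw [f.map_adj_iff, cycleGraph_adj', add_sub_add_left_eq_sub, add_sub_add_left_eq_sub,
      ← cycleGraph_adj', cycleGraph_adj_iff_val (by omega)]
    simp only [Fin.val_ofNat, Nat.mod_eq_of_lt, hk', hl']
    omega

namespace IsIndPath

variable {k : ℕ} {p : ℕ → V}

theorem adj_iff (h : IsIndPath G k p) {i j : ℕ} (hi : i < k) (hj : j < k) :
    G.Adj (p i) (p j) ↔ i + 1 = j ∨ j + 1 = i := (h i hi j hj).2

theorem ne (h : IsIndPath G k p) {i j : ℕ} (hi : i < k) (hj : j < k) (hij : i ≠ j) :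
    p i ≠ p j := fun e => hij ((h i hi j hj).1 e)

theorem isP5 (h : IsIndPath G k p) {i : ℕ} (hi : i + 5 ≤ k) :
    IsP5 G (p i) (p (i + 1)) (p (i + 2)) (p (i + 3)) (p (i + 4)) := by
  refine ⟨⟨?_, ?_, ?_, ?_⟩, ⟨?_, ?_, ?_, ?_, ?_, ?_⟩, ?_, ?_, ?_, ?_, ?_, ?_⟩
  all_goals first
    | exact h.ne (by omega) (by omega) (by omega)
    | (rw [h.adj_iff (by omega) (by omega)]; omega)

theorem cons (h : IsIndPath G k p) {w : V} (hw : ∀ i < k, w ≠ p i)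
    (hA : ∀ i < k, G.Adj w (p i) ↔ i = 0) :
    IsIndPath G (k + 1) (fun i => Nat.casesOn i w p) := by
  rintro (_ | i) hi (_ | j) hj
  · simp
  · have h1 := hw j (by omega)
    have h2 := hA j (by omega)
    simp [h1, h2]
  · have h1 := (hw i (by omega)).symm
    have h2 := hA i (by omega)
    simp [h1, G.adj_comm (p i) w, h2]
  · simpa using h i (by omega) j (by omega)

theorem reverse (h : IsIndPath G (k + 1) p) : IsIndPath G (k + 1) (fun i => p (k - i)) := by
  intro i hi j hj
  have := h (k - i) (by omega) (k - j) (by omega)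
  refine ⟨fun e => ?_, ?_⟩
  · have := this.1 e
    omega
  · rw [this.2]
    omega

theorem le_card [Finite V] (h : IsIndPath G k p) : k ≤ Nat.card V := by
  have : Function.Injective fun i : Fin k => p i := fun i j e =>
    Fin.ext ((h i i.2 j j.2).1 e)
  simpa using Nat.card_le_card_of_injective _ this

theorem nonempty_cycleGraph_embedding {m : ℕ} (h : IsIndPath G (m + 2) p) {w : V}
    (hw : ∀ i < m + 2, w ≠ p i) (hA : ∀ i < m + 2, G.Adj w (p i) ↔ i = 0 ∨ i = m + 1) :
    Nonempty (cycleGraph (m + 3) ↪g G) := by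
  refine ⟨⟨⟨fun i => if i.val < m + 2 then p i.val else w, ?_⟩, ?_⟩⟩
  · intro i j
    have := i.2
    have := j.2
    dsimp only
    split_ifs with hi hj hj
    · exact fun e => Fin.ext ((h _ hi _ hj).1 e)
    · exact fun e => absurd e.symm (hw _ hi)
    · exact fun e => absurd e (hw _ hj)
    · exact fun _ => Fin.ext (by omega)
  · intro i j
    have := i.2
    have := j.2
    rw [cycleGraph_adj_iff_val (by omega)]
    change G.Adj (if i.val < m + 2 then p i.val else w) (if j.val < m + 2 then p j.val else w) ↔ _
    split_ifs with hi hj hj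
    · rw [h.adj_iff hi hj]
      omega
    · rw [G.adj_comm, hA _ hi]
      omega
    · rw [hA _ hj]
      omega
    · simp only [SimpleGraph.irrefl, false_iff]
      omega

end IsIndPath

theorem mem_range_of_adj_of_cycleGraph_embedding (hC : ClawFree G) (hH : HammerFree G) {m : ℕ}
    (f : cycleGraph (m + 7) ↪g G) {i : Fin (m + 7)} {v : V} (hv : G.Adj (f i) v) :
    v ∈ Set.range f := by
  by_contra hr
  have hne : ∀ j, v ≠ f j := fun j e => hr ⟨j, e.symm⟩
  have step : ∀ j, G.Adj v (f j) → G.Adj v (f (j + 1)) := by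
    intro j hj
    have h0 := isIndPath_of_cycleGraph_embedding f (j - 1)
    have h1 := isIndPath_of_cycleGraph_embedding f j
    have p0 := h0.isP5 (i := 0) (by norm_num)
    have p1 := h1.isP5 (i := 0) (by norm_num)
    have p2 := h1.isP5 (i := 1) (by norm_num)
    have e1 : f (j + Fin.ofNat (m + 7) 0) = f j := by congr 1; simp
    have e2 : ∀ k, f (j - 1 + Fin.ofNat (m + 7) (k + 1)) = f (j + Fin.ofNat (m + 7) k) := by
      intro k
      have : Fin.ofNat (m + 7) (k + 1) = Fin.ofNat (m + 7) k + 1 := by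
        simp [Fin.ext_iff, Fin.val_add]
      rw [this]
      congr 1
      abel
    simp only [e2] at p0
    exact adj_succ_of_adj_of_isP5 hC hH p0 p1 p2
      (by rw [h1.adj_iff (i := 0) (by norm_num) (by norm_num)]; norm_num)
      (h1.ne (i := 0) (by norm_num) (by norm_num) (by norm_num)) (hne _) (hne _) (hne _)
      (e1 ▸ hj)
  have all : ∀ k : ℕ, G.Adj v (f (i + Fin.ofNat (m + 7) k)) := by
    intro k
    induction k with
    | zero => simpa using hv.symm
    | succ k ih =>
      have : i + Fin.ofNat (m + 7) (k + 1) = i + Fin.ofNat (m + 7) k + 1 := by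
        rw [add_assoc]
        congr 1
        simp [Fin.ext_iff, Fin.val_add]
      rw [this]
      exact step _ ih
  obtain ⟨-, ⟨ac, -, ae, -, -, ce⟩, ac', -, ae', -, -, ce'⟩ :=
    (isIndPath_of_cycleGraph_embedding f i).isP5 (i := 0) (by norm_num)
  rcases hC v _ _ _ (all 0) (all 2) (all 4) ac' ae' ce' with h | h | h
  exacts [ac h, ae h, ce h]

theorem nonempty_iso_of_cycleGraph_embedding (hC : ClawFree G) (hH : HammerFree G)
    (hG : G.Connected) {m : ℕ} (f : cycleGraph (m + 7) ↪g G) :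
    Nonempty (G ≃g cycleGraph (m + 7)) := by
  have hs : Function.Surjective f := fun v =>
    hG.mem_of_adj_closed_s7 (U := Set.range f) (Set.mem_range_self 0)
      (by rintro _ ⟨i, rfl⟩ y hy; exact mem_range_of_adj_of_cycleGraph_embedding hC hH f hy) v
  exact ⟨(RelIso.ofSurjective f hs).symm⟩

/-- If an end of a maximum induced path on at least six vertices is not pendant, then the path
closes up to a hole with one more vertex. -/
theorem IsIndPath.nonempty_cycleGraph_embedding_of_maximum (hC : ClawFree G) (hH : HammerFree G)
    {m : ℕ} {p : ℕ → V} (h : IsIndPath G (m + 6) p) (hmax : ∀ q, ¬ IsIndPath G (m + 7) q)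
    (hpend : ∀ v u : V, G.Adj v u → ∃ w, G.Adj v w ∧ w ≠ u) :
    Nonempty (cycleGraph (m + 7) ↪g G) := by
  obtain ⟨w, hw, hw1⟩ := hpend (p 0) (p 1)
    ((h.adj_iff (by omega) (by omega)).2 (by omega))
  have hne : ∀ i < m + 6, w ≠ p i := by
    rintro i hi rfl
    rw [h.adj_iff (by omega) hi] at hw
    obtain rfl : i = 1 := by omega
    exact hw1 rfl
  obtain ⟨n1, n2⟩ := hC.not_adj_two_apart_of_isIndPath_six hH (h.isP5 (i := 0) (by omega))
    (h.isP5 (i := 1) (by omega))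
    (by rw [h.adj_iff (by omega) (by omega)]; omega)
    (h.ne (by omega) (by omega) (by omega)) (hne _ (by omega)) (hne _ (by omega))
    (hne _ (by omega)) (hne _ (by omega)) hw.symm
  by_cases hex : ∃ j, j < m + 6 ∧ j ≠ 0 ∧ G.Adj w (p j)
  · classical
    obtain ⟨hjk, hj0, hj⟩ := Nat.find_spec hex
    have hmin := fun i => @Nat.find_min _ _ hex i
    generalize Nat.find hex = j at hjk hj0 hj hmin
    have hj3 : 3 ≤ j := by
      rcases j with _ | _ | _ | j
      · exact absurd rfl hj0
      · exact absurd hj n1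
      · exact absurd hj n2
      · omega
    have hlast : j = m + 5 := by
      by_contra hlt
      have nprev : ¬ G.Adj w (p (j - 1)) := fun hadj =>
        hmin (j - 1) (by omega) ⟨by omega, by omega, hadj⟩
      have hnext : G.Adj w (p (j + 1)) := by
        rcases hC (p j) (p (j - 1)) (p (j + 1)) w
          ((h.adj_iff (by omega) (by omega)).2 (by omega))
          ((h.adj_iff (by omega) (by omega)).2 (by omega)) hj.symm
          (h.ne (by omega) (by omega) (by omega)) (hne _ (by omega)).symm
          (hne _ (by omega)).symm with h1 | h1 | h1
        · rw [h.adj_iff (by omega) (by omega)] at h1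
          omega
        · exact absurd h1.symm nprev
        · exact h1.symm
      rcases hH w (p j) (p (j + 1)) (p 0) (p 1) hj hnext
        ((h.adj_iff (by omega) (by omega)).2 (by omega)) hw.symm
        ((h.adj_iff (by omega) (by omega)).2 (by omega)) with h1 | h1 | h1 | h1 | h1
      · exact n1 h1
      all_goals
        rw [h.adj_iff (by omega) (by omega)] at h1
        omega
    subst hlast
    refine IsIndPath.nonempty_cycleGraph_embedding h hne fun i hi => ⟨fun hadj => ?_, ?_⟩
    · by_contra hi'
      exact hmin i (by omega) ⟨by omega, by omega, hadj⟩
    · rintro (rfl | rfl)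
      · exact hw.symm
      · exact hj
  · refine absurd (h.cons hne fun i hi => ⟨fun hadj => ?_, ?_⟩) (hmax _)
    · by_contra hi'
      exact hex ⟨i, hi, hi', hadj⟩
    · rintro rfl
      exact hw.symm

theorem exists_five_set_of_isC5 (hC : ClawFree G) (hH : HammerFree G) (hG : G.Connected)
    {a b c d e : V} (hP : IsC5 G a b c d e) :
    ∃ S : Set V, S.ncard ≤ 5 ∧
      ¬ ∃ a b c : V, a ∉ S ∧ b ∉ S ∧ c ∉ S ∧ a ≠ b ∧ a ≠ c ∧ b ≠ c ∧
        ¬ G.Adj a b ∧ ¬ G.Adj a c ∧ ¬ G.Adj b c := by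
  refine ⟨{a, b, c, d, e}, Set.ncard_insert_five_le a b c d e,
    IsC5.not_three_independent (a := a) (b := b) (c := c) (d := d) (e := e) hC ?_⟩
  have pat : ∀ v ∉ ({a, b, c, d, e} : Set V), (∃ u ∈ ({a, b, c, d, e} : Set V), G.Adj v u) →
      MeetsC5 G v a b c d e :=
    fun v hv hu => hP.neighbour_pattern hC hH (v := v)
      (by rintro rfl; simp at hv) (by rintro rfl; simp at hv) (by rintro rfl; simp at hv)
      (by rintro rfl; simp at hv) (by rintro rfl; simp at hv) (by simpa using hu)
  refine fun v hv => pat v hv (hC.exists_adj_of_not_mem hG (t := a) (by simp) ?_ hv)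
  intro v hv hu
  obtain ⟨⟨ab, bc, cd, de, ea⟩, ac, ad, bd, be, ce⟩ := hP
  have hac : a ≠ c := by rintro rfl; exact ad cd
  have hbd : b ≠ d := by rintro rfl; exact be de
  have hce : c ≠ e := by rintro rfl; exact ac ea.symm
  rcases pat v hv hu with h | h | h | h | h
  · exact ⟨a, by simp, c, by simp, hac, ac, h.1, h.2.2.1⟩
  · exact ⟨b, by simp, d, by simp, hbd, bd, h.1, h.2.2.1⟩
  · exact ⟨c, by simp, e, by simp, hce, ce, h.1, h.2.2.1⟩
  · exact ⟨d, by simp, a, by simp, by rintro rfl; exact ac cd.symm, mt G.adj_symm ad, h.1, h.2.2.1⟩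
  · exact ⟨e, by simp, b, by simp, by rintro rfl; exact ce bc.symm, mt G.adj_symm be, h.1, h.2.2.1⟩

theorem IsIndPath.exists_five_set_of_maximum (hC : ClawFree G) (hH : HammerFree G)
    (hG : G.Connected) (h5 : ∀ a b c d e, ¬ IsC5 G a b c d e)
    (h6 : ∀ a b c d e f, ¬ IsC6 G a b c d e f)
    {p : ℕ → V} (h : IsIndPath G 5 p) (hmax : ∀ q, ¬ IsIndPath G 6 q) :
    ∃ S : Set V, S.ncard ≤ 5 ∧
      ¬ ∃ a b c : V, a ∉ S ∧ b ∉ S ∧ c ∉ S ∧ a ≠ b ∧ a ≠ c ∧ b ≠ c ∧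
        ¬ G.Adj a b ∧ ¬ G.Adj a c ∧ ¬ G.Adj b c := by
  have hP : IsP5 G (p 0) (p 1) (p 2) (p 3) (p 4) := h.isP5 (i := 0) le_rfl
  refine ⟨{p 0, p 1, p 2, p 3, p 4}, Set.ncard_insert_five_le _ _ _ _ _,
    hP.not_three_independent hC h6 ?_⟩
  have ext : ∀ q : ℕ → V, IsIndPath G 5 q → ∀ v, (∀ i < 5, v ≠ q i) → G.Adj v (q 0) →
      G.Adj v (q 1) ∨ G.Adj v (q 2) ∨ G.Adj v (q 3) ∨ G.Adj v (q 4) := by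
    intro q hq v hv h0
    by_contra! hn
    refine hmax _ (hq.cons hv fun i hi => ?_)
    interval_cases i <;> simp_all
  have pat : ∀ v ∉ ({p 0, p 1, p 2, p 3, p 4} : Set V),
      (∃ u ∈ ({p 0, p 1, p 2, p 3, p 4} : Set V), G.Adj v u) →
      MeetsP5 G v (p 0) (p 1) (p 2) (p 3) (p 4) := by
    intro v hv hu
    have hne : ∀ i < 5, v ≠ p i := by
      rintro i hi rfl
      interval_cases i <;> simp at hv
    have hR := ext _ h.reverse v (fun i hi => hne _ (by omega))
    exact hP.neighbour_pattern hC hH h5 h6 (hne 0 (by omega)) (hne 1 (by omega))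
      (hne 2 (by omega)) (hne 3 (by omega)) (hne 4 (by omega)) (ext p h v hne)
      (fun h4 => by rcases hR h4 with h | h | h | h <;> simp_all) (by simpa using hu)
  refine fun v hv => pat v hv (hC.exists_adj_of_not_mem hG (t := p 0) (by simp) ?_ hv)
  intro v hv hu
  obtain ⟨-, ⟨ac, ad, ae, bd, be, ce⟩, ac', ad', ae', bd', be', ce'⟩ := hP
  rcases pat v hv hu with h | h | h
  · exact ⟨p 1, by simp, p 3, by simp, bd', bd, h.1, h.2.1⟩
  · exact ⟨p 0, by simp, p 2, by simp, ac', ac, h.1, h.2.2.1⟩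
  · exact ⟨p 2, by simp, p 4, by simp, ce', ce, h.2.2.1, h.2.2.2.2⟩

end

/-- Structure of connected `{K_{1,3}, hammer}`-free graphs: one of five
alternatives holds. -/
theorem claw_hammer_free_structure {V : Type*} (G : SimpleGraph V) (hconn : G.Connected)
    (hclaw : ¬ Nonempty (completeBipartiteGraph (Fin 1) (Fin 3) ↪g G))
    (hham : ¬ Nonempty (hammer ↪g G)) :
    (∃ n : ℕ, 3 ≤ n ∧ Nonempty (G ≃g cycleGraph n)) ∨
      Nonempty (cycleGraph 6 ↪g G) ∨
      (∃ v : V, ∃! u : V, G.Adj v u) ∨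
      ¬ Nonempty (pathGraph 5 ↪g G) ∨
      (∃ S : Set V, S.ncard ≤ 5 ∧
        ¬ ∃ a b c : V, a ∉ S ∧ b ∉ S ∧ c ∉ S ∧ a ≠ b ∧ a ≠ c ∧ b ≠ c ∧
          ¬ G.Adj a b ∧ ¬ G.Adj a c ∧ ¬ G.Adj b c) := by
  have hC := clawFree_of_not_nonempty_embedding hclaw
  have hH := hammerFree_of_not_nonempty_embedding hham
  rcases finite_or_infinite V with hV | hV
  swap
  · exact .inr <| .inr <| .inr <| .inr ⟨Set.univ, by simp [Set.infinite_univ.ncard], by simp⟩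
  by_cases h6 : ∀ a b c d e f, ¬ IsC6 G a b c d e f
  swap
  · push Not at h6
    obtain ⟨a, b, c, d, e, f, h⟩ := h6
    exact .inr <| .inl h.nonempty_embedding
  by_cases hpend : ∃ v : V, ∃! u : V, G.Adj v u
  · exact .inr <| .inr <| .inl hpend
  by_cases hP : Nonempty (pathGraph 5 ↪g G)
  swap
  · exact .inr <| .inr <| .inr <| .inl hP
  by_cases h5 : ∀ a b c d e, ¬ IsC5 G a b c d e
  swap
  · push Not at h5
    obtain ⟨a, b, c, d, e, h⟩ := h5
    exact .inr <| .inr <| .inr <| .inr (exists_five_set_of_isC5 hC hH hconn h)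
  have hpend' : ∀ v u : V, G.Adj v u → ∃ w, G.Adj v w ∧ w ≠ u := by
    intro v u hvu
    by_contra! hn
    exact hpend ⟨v, u, hvu, hn⟩
  obtain ⟨f⟩ := hP
  have hbdd : BddAbove {k | ∃ p, IsIndPath G k p} := ⟨Nat.card V, fun k ⟨_, h⟩ => h.le_card⟩
  have h5mem : 5 ∈ {k | ∃ p, IsIndPath G k p} := ⟨_, isIndPath_of_pathGraph_embedding f⟩
  obtain ⟨p, hp⟩ := Nat.sSup_mem ⟨5, h5mem⟩ hbdd
  have hge := le_csSup hbdd h5mem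
  have hmax : ∀ q, ¬ IsIndPath G (sSup {k | ∃ p, IsIndPath G k p} + 1) q := fun q hq =>
    absurd (le_csSup hbdd ⟨q, hq⟩) (by omega)
  generalize sSup {k | ∃ p, IsIndPath G k p} = k at hp hge hmax
  obtain rfl | hk := hge.eq_or_lt
  · exact .inr <| .inr <| .inr <| .inr (hp.exists_five_set_of_maximum hC hH hconn h5 h6 hmax)
  · obtain ⟨m, rfl⟩ := Nat.exists_eq_add_of_lt hk
    rw [show 5 + m + 1 = m + 6 by omega] at hp hmax
    obtain ⟨e⟩ := hp.nonempty_cycleGraph_embedding_of_maximum hC hH hmax hpend'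
    exact .inl ⟨m + 7, by omega, nonempty_iso_of_cycleGraph_embedding hC hH hconn e⟩
end
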